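/- arXiv:1603.01720 — 2 statements merged into one kernel-verified Lean document; each statement's English description precedes it below -/
import Mathlib

section
/- Let a, b be real numbers with a > -1, |b| < 1 and |b| < 1 + a. Then there exist constants c, C > 0, depending only on a and b, such that for all s, t > 0: c · (t·s)^a · (min(t,s))^{1+b} · |t-s|^{1+b} ≤ t^{1+a+b}·s^{1+a+b} - R_{a,b}(t,s)^2 ≤ C · (t·s)^a · (min(t,s))^{1+b} · |t-s|^{1+b}. -/
open Real MeasureTheory

/-- The Euler Beta function. -/
noncomputable def Beta (x y : ℝ) : ℝ := Real.Gamma x * Real.Gamma y / Real.Gamma (x + y)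

/-- The covariance function `R_{a,b}(t,s)` of the weighted fractional Brownian motion. -/
noncomputable def R (a b t s : ℝ) : ℝ :=
  (1 / (2 * Beta (a + 1) (b + 1))) *
    ∫ u in (0:ℝ)..(min t s), u ^ a * ((t - u) ^ b + (s - u) ^ b)

open Set Filter Topology

/-- The unnormalised incomplete Beta integral. -/
noncomputable def incBeta (a b x : ℝ) : ℝ := ∫ u in (0:ℝ)..x, u ^ a * (1 - u) ^ b

/-- The correlation of the weighted fractional Brownian motion between times `1` and `x`. -/
noncomputable def corr (a b x : ℝ) : ℝ :=
  (x ^ ((1 + a + b) / 2) + x ^ (-((1 + a + b) / 2)) * (incBeta a b x / Beta (a + 1) (b + 1))) / 2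

lemma intervalIntegrable_beta {a b : ℝ} (ha : -1 < a) (hb : -1 < b) :
    IntervalIntegrable (fun u : ℝ => u ^ a * (1 - u) ^ b) volume 0 1 := by
  have left : ∀ {a b : ℝ}, -1 < a →
      IntervalIntegrable (fun u : ℝ => u ^ a * (1 - u) ^ b) volume 0 (1 / 2) := by
    intro a b ha
    apply IntervalIntegrable.mul_continuousOn (intervalIntegral.intervalIntegrable_rpow' ha)
    apply ContinuousOn.rpow_const (by fun_prop)
    intro x hx
    rw [uIcc_of_le (by norm_num)] at hx
    left
    have := hx.2
    intro h
    linarith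
  refine (left ha).trans ?_
  rw [IntervalIntegrable.iff_comp_neg]
  convert! ((left (b := a) hb).comp_add_right 1).symm using 1
  · ext1 x
    conv_lhs => rw [mul_comm]
    congr 2 <;> ring
  · norm_num
  · norm_num

lemma Beta_pos {a b : ℝ} (ha : -1 < a) (hb : -1 < b) : 0 < Beta (a + 1) (b + 1) :=
  ProbabilityTheory.beta_pos (by linarith) (by linarith)

lemma incBeta_one {a b : ℝ} (ha : -1 < a) (hb : -1 < b) :
    incBeta a b 1 = Beta (a + 1) (b + 1) := by
  have h := ProbabilityTheory.beta_eq_betaIntegralReal (a + 1) (b + 1) (by linarith) (by linarith)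
  have h' : Beta (a + 1) (b + 1) = ProbabilityTheory.beta (a + 1) (b + 1) := rfl
  rw [h', h, Complex.betaIntegral, incBeta]
  have : ∫ x in (0:ℝ)..1, (x : ℂ) ^ (((a + 1 : ℝ) : ℂ) - 1) * (1 - (x : ℂ)) ^ (((b + 1 : ℝ) : ℂ) - 1)
      = ∫ x in (0:ℝ)..1, ((x ^ a * (1 - x) ^ b : ℝ) : ℂ) := by
    apply intervalIntegral.integral_congr
    intro x hx
    rw [uIcc_of_le zero_le_one] at hx
    simp only [Complex.ofReal_mul]
    rw [Complex.ofReal_cpow hx.1, Complex.ofReal_cpow (by linarith [hx.2])]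
    push_cast
    congr 2 <;> ring
  rw [this, intervalIntegral.integral_ofReal, Complex.ofReal_re]

lemma hasDerivAt_incBeta {a b x : ℝ} (ha : -1 < a) (hb : -1 < b) (hx : x ∈ Ioo (0:ℝ) 1) :
    HasDerivAt (incBeta a b) (x ^ a * (1 - x) ^ b) x := by
  have hc : ∀ y ∈ Ioo (0:ℝ) 1, ContinuousAt (fun u : ℝ => u ^ a * (1 - u) ^ b) y := by
    intro y hy
    apply ContinuousAt.mul
    · exact continuousAt_id.rpow_const (Or.inl hy.1.ne')
    · exact ContinuousAt.rpow_const (by fun_prop) (Or.inl (by linarith [hy.2] : (0:ℝ) < 1 - y).ne')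
  apply intervalIntegral.integral_hasDerivAt_right
  · apply (intervalIntegrable_beta ha hb).mono_set
    rw [uIcc_of_le hx.1.le, uIcc_of_le zero_le_one]
    exact Icc_subset_Icc_right hx.2.le
  · exact ContinuousAt.stronglyMeasurableAtFilter isOpen_Ioo hc x hx
  · exact hc x hx

lemma continuousOn_incBeta {a b : ℝ} (ha : -1 < a) (hb : -1 < b) :
    ContinuousOn (incBeta a b) (Icc 0 1) := by
  have := intervalIntegral.continuousOn_primitive_interval' (intervalIntegrable_beta ha hb)
    (a := 0) (by simp)
  rwa [uIcc_of_le zero_le_one] at this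

lemma incBeta_zero (a b : ℝ) : incBeta a b 0 = 0 := by simp [incBeta]

lemma incBeta_nonneg {a b x : ℝ} (hx : x ∈ Icc (0:ℝ) 1) : 0 ≤ incBeta a b x := by
  apply intervalIntegral.integral_nonneg hx.1
  intro u hu
  exact mul_nonneg (rpow_nonneg hu.1 _) (rpow_nonneg (by linarith [hu.2, hx.2]) _)

lemma integral_eq_mul_incBeta {a b t s : ℝ} (ht : 0 < t) (hs : 0 ≤ s) (hst : s ≤ t) :
    ∫ u in (0:ℝ)..s, u ^ a * (t - u) ^ b = t ^ (1 + a + b) * incBeta a b (s / t) := by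
  have h := intervalIntegral.smul_integral_comp_mul_left (a := 0) (b := s / t)
    (fun u : ℝ => u ^ a * (t - u) ^ b) t
  rw [mul_zero, mul_div_cancel₀ _ ht.ne'] at h
  rw [← h, incBeta, ← intervalIntegral.integral_const_mul, smul_eq_mul,
    ← intervalIntegral.integral_const_mul]
  apply intervalIntegral.integral_congr
  intro u hu
  rw [uIcc_of_le (by positivity)] at hu
  have hu1 : 0 ≤ 1 - u := by
    have := hu.2.trans ((div_le_one ht).2 hst)
    linarith
  simp only
  rw [show t - t * u = t * (1 - u) by ring, mul_rpow ht.le hu.1, mul_rpow ht.le hu1,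
    add_assoc, rpow_add ht, rpow_add ht, rpow_one]
  ring

lemma R_eq_mul_corr {a b t s : ℝ} (ha : -1 < a) (hb : -1 < b) (hs : 0 < s) (hst : s ≤ t) :
    R a b t s = t ^ ((1 + a + b) / 2) * s ^ ((1 + a + b) / 2) * corr a b (s / t) := by
  have ht : 0 < t := hs.trans_le hst
  have hB := Beta_pos ha hb
  have hint : ∀ r, s ≤ r → IntervalIntegrable (fun u : ℝ => u ^ a * (r - u) ^ b) volume 0 s := by
    intro r hr
    have hr0 : 0 < r := hs.trans_le hr
    have h1 := (intervalIntegrable_beta ha hb).comp_mul_left (c := r⁻¹)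
    simp only [zero_div, one_div, inv_inv] at h1
    have h2 : IntervalIntegrable (fun u : ℝ => u ^ a * (r - u) ^ b) volume 0 r := by
      refine (h1.const_mul (r ^ a * r ^ b)).congr ?_
      intro u hu
      rw [uIoc_of_le hr0.le] at hu
      have h3 : 0 ≤ 1 - r⁻¹ * u := by
        rw [inv_mul_eq_div]
        linarith [(div_le_one hr0).2 hu.2]
      have h4 : 0 ≤ r⁻¹ * u := mul_nonneg (inv_nonneg.2 hr0.le) hu.1.le
      have e1 : u ^ a = r ^ a * (r⁻¹ * u) ^ a := by
        rw [← mul_rpow hr0.le h4]; congr 1; field_simp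
      have e2 : (r - u) ^ b = r ^ b * (1 - r⁻¹ * u) ^ b := by
        rw [← mul_rpow hr0.le h3]; congr 1; field_simp
      simp only [e1, e2]
      ring
    apply h2.mono_set
    rw [uIcc_of_le hs.le, uIcc_of_le hr0.le]
    exact Icc_subset_Icc_right hr
  have hsplit : R a b t s = (1 / (2 * Beta (a + 1) (b + 1))) *
      (t ^ (1 + a + b) * incBeta a b (s / t) + s ^ (1 + a + b) * Beta (a + 1) (b + 1)) := by
    rw [R, min_eq_right hst]
    simp only [mul_add]
    rw [intervalIntegral.integral_add (hint t hst) (hint s le_rfl),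
      integral_eq_mul_incBeta ht hs.le hst, integral_eq_mul_incBeta hs hs.le le_rfl,
      div_self hs.ne', incBeta_one ha hb]
    ring
  rw [hsplit, corr, div_rpow hs.le ht.le, div_rpow hs.le ht.le, rpow_neg hs.le, rpow_neg ht.le,
    show (1 + a + b) = (1 + a + b) / 2 + (1 + a + b) / 2 by ring, rpow_add ht, rpow_add hs]
  have h1 := rpow_pos_of_pos ht ((1 + a + b) / 2)
  have h2 := rpow_pos_of_pos hs ((1 + a + b) / 2)
  rw [show ((1 + a + b) / 2 + (1 + a + b) / 2) / 2 = (1 + a + b) / 2 by ring]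
  field_simp
  ring

lemma mul_one_sub_rpow_lt {b m x : ℝ} (hb1 : b < 1) (hm : 0 < m) (hbm : b < m)
    (hx : x ∈ Ioo (0:ℝ) 1) : b * (1 - x ^ m) < m * (1 - x) := by
  have hx1 : 0 < 1 - x := by linarith [hx.2]
  have hxm : 0 < 1 - x ^ m := by linarith [rpow_lt_one hx.1.le hx.2 hm]
  rcases le_or_gt b 0 with hb | hb
  · nlinarith [mul_pos hm hx1, mul_nonneg (neg_nonneg.2 hb) hxm.le]
  rcases le_or_gt m 1 with h | h
  · have := rpow_le_rpow_of_exponent_ge hx.1 hx.2.le h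
    rw [rpow_one] at this
    nlinarith
  · have := one_add_mul_self_le_rpow_one_add (s := x - 1) (by linarith [hx.1]) h.le
    rw [show 1 + (x - 1) = x by ring] at this
    nlinarith

lemma strictAntiOn_log_ratio {b m : ℝ} (hb1 : b < 1) (hm : 0 < m) (hbm : b < m) :
    StrictAntiOn (fun x : ℝ => -(m - b) * log x + log (1 - x ^ m) - b * log (1 - x))
      (Ioo 0 1) := by
  have hd : ∀ x ∈ Ioo (0:ℝ) 1, HasDerivAt
      (fun x : ℝ => -(m - b) * log x + log (1 - x ^ m) - b * log (1 - x))
      (-(m - b) * x⁻¹ + (-(m * x ^ (m - 1))) / (1 - x ^ m) - b * ((-1) / (1 - x))) x := by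
    intro x hx
    have hx1 : 0 < 1 - x := by linarith [hx.2]
    have hxm : 0 < 1 - x ^ m := by linarith [rpow_lt_one hx.1.le hx.2 hm]
    refine (((hasDerivAt_log hx.1.ne').const_mul _).add ?_).sub (HasDerivAt.const_mul _ ?_)
    · exact ((hasDerivAt_rpow_const (Or.inl hx.1.ne')).const_sub 1).log hxm.ne'
    · exact ((hasDerivAt_id x).const_sub 1).log hx1.ne'
  apply strictAntiOn_of_deriv_neg (convex_Ioo 0 1)
  · exact fun x hx => (hd x hx).continuousAt.continuousWithinAt
  · intro x hx
    rw [interior_Ioo] at hx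
    rw [(hd x hx).deriv]
    have hx0 := hx.1
    have hx1 : 0 < 1 - x := by linarith [hx.2]
    have hxm : 0 < 1 - x ^ m := by linarith [rpow_lt_one hx.1.le hx.2 hm]
    have key := mul_one_sub_rpow_lt hb1 hm hbm hx
    rw [rpow_sub_one hx.1.ne']
    have : -(m - b) * x⁻¹ + (-(m * (x ^ m / x))) / (1 - x ^ m) - b * ((-1) / (1 - x)) =
        (b * (1 - x ^ m) - m * (1 - x)) / (x * (1 - x) * (1 - x ^ m)) := by
      field_simp
      ring
    rw [this]
    exact div_neg_of_neg_of_pos (by linarith) (by positivity)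

lemma gap_pos {a b x : ℝ} (ha : -1 < a) (hb1 : |b| < 1) (hb2 : |b| < 1 + a)
    (hx : x ∈ Ioo (0:ℝ) 1) :
    (1 - x ^ ((1 + a + b) / 2)) ^ 2 < 1 - incBeta a b x / Beta (a + 1) (b + 1) := by
  have hb := abs_lt.1 hb1
  have hb' := abs_lt.1 hb2
  have hB := Beta_pos ha hb.1
  set B := Beta (a + 1) (b + 1) with hBdef
  obtain ⟨m, hmdef⟩ : ∃ m, m = (1 + a + b) / 2 := ⟨_, rfl⟩
  rw [← hmdef]
  have hm : 0 < m := by linarith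
  have hbm : b < m := by linarith
  let h : ℝ → ℝ := fun x => 1 - incBeta a b x / B - (1 - x ^ m) ^ 2
  let h' : ℝ → ℝ := fun x => -(x ^ a * (1 - x) ^ b / B) + 2 * (1 - x ^ m) * (m * x ^ (m - 1))
  have hd : ∀ y ∈ Ioo (0:ℝ) 1, HasDerivAt h (h' y) y := by
    intro y hy
    have h1 := ((hasDerivAt_incBeta ha hb.1 hy).div_const B).const_sub 1
    have h2 := (((hasDerivAt_rpow_const (p := m) (Or.inl hy.1.ne')).const_sub 1).pow 2)
    refine (h1.sub h2).congr_deriv ?_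
    simp only [h']
    push_cast
    ring
  have hc : ContinuousOn h (Icc 0 1) := by
    have h1 := continuousOn_incBeta ha hb.1
    have h2 : ContinuousOn (fun x : ℝ => x ^ m) (Icc 0 1) :=
      continuousOn_id.rpow_const fun _ _ => Or.inr hm.le
    exact ((continuousOn_const.sub (h1.div_const B))).sub ((continuousOn_const.sub h2).pow 2)
  have h0 : h 0 = 0 := by simp [h, incBeta_zero, zero_rpow hm.ne']
  have h1 : h 1 = 0 := by simp [h, incBeta_one ha hb.1, ← hBdef, hB.ne']
  by_contra hcon
  have hx0 : h x ≤ 0 := by simp only [h]; linarith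
  obtain ⟨ξ, hξ, hξ'⟩ := exists_hasDerivAt_eq_slope h h' hx.1
    (hc.mono (Icc_subset_Icc_right hx.2.le)) (fun y hy => hd y ⟨hy.1, hy.2.trans hx.2⟩)
  obtain ⟨η, hη, hη'⟩ := exists_hasDerivAt_eq_slope h h' hx.2
    (hc.mono (Icc_subset_Icc_left hx.1.le)) (fun y hy => hd y ⟨hx.1.trans hy.1, hy.2⟩)
  rw [h0] at hξ'
  rw [h1] at hη'
  have hξneg : h' ξ ≤ 0 := by
    rw [hξ']; exact div_nonpos_of_nonpos_of_nonneg (by linarith) (by linarith [hx.1])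
  have hηpos : 0 ≤ h' η := by
    rw [hη']; exact div_nonneg (by linarith) (by linarith [hx.2])
  have hξI : ξ ∈ Ioo (0:ℝ) 1 := ⟨hξ.1, hξ.2.trans hx.2⟩
  have hηI : η ∈ Ioo (0:ℝ) 1 := ⟨hx.1.trans hη.1, hη.2⟩
  have hanti := strictAntiOn_log_ratio hb.2 hm hbm hξI hηI (hξ.2.trans hη.1)
  have logL : ∀ y ∈ Ioo (0:ℝ) 1, log (y ^ a * (1 - y) ^ b / B) =
      a * log y + b * log (1 - y) - log B := by
    intro y hy
    have hy1 : 0 < 1 - y := by linarith [hy.2]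
    rw [log_div (mul_pos (rpow_pos_of_pos hy.1 _) (rpow_pos_of_pos hy1 _)).ne' hB.ne',
      log_mul (rpow_pos_of_pos hy.1 _).ne' (rpow_pos_of_pos hy1 _).ne', log_rpow hy.1,
      log_rpow hy1]
  have logR : ∀ y ∈ Ioo (0:ℝ) 1, log (2 * (1 - y ^ m) * (m * y ^ (m - 1))) =
      log 2 + log (1 - y ^ m) + (log m + (m - 1) * log y) := by
    intro y hy
    have hym : 0 < 1 - y ^ m := by linarith [rpow_lt_one hy.1.le hy.2 hm]
    have hyp := rpow_pos_of_pos hy.1 (m - 1)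
    rw [log_mul (by positivity) (by positivity), log_mul (by positivity) hym.ne',
      log_mul hm.ne' hyp.ne', log_rpow hy.1]
  have posL : ∀ y ∈ Ioo (0:ℝ) 1, 0 < y ^ a * (1 - y) ^ b / B := by
    intro y hy
    have hy1 : 0 < 1 - y := by linarith [hy.2]
    exact div_pos (mul_pos (rpow_pos_of_pos hy.1 _) (rpow_pos_of_pos hy1 _)) hB
  have posR : ∀ y ∈ Ioo (0:ℝ) 1, 0 < 2 * (1 - y ^ m) * (m * y ^ (m - 1)) := by
    intro y hy
    have hym : 0 < 1 - y ^ m := by linarith [rpow_lt_one hy.1.le hy.2 hm]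
    have hyp := rpow_pos_of_pos hy.1 (m - 1)
    positivity
  have i1 := log_le_log (posR ξ hξI)
    (show 2 * (1 - ξ ^ m) * (m * ξ ^ (m - 1)) ≤ ξ ^ a * (1 - ξ) ^ b / B by
      simp only [h'] at hξneg; linarith)
  have i2 := log_le_log (posL η hηI)
    (show η ^ a * (1 - η) ^ b / B ≤ 2 * (1 - η ^ m) * (m * η ^ (m - 1)) by
      simp only [h'] at hηpos; linarith)
  rw [logL ξ hξI, logR ξ hξI] at i1
  rw [logL η hηI, logR η hηI] at i2
  have ham : a = 2 * m - b - 1 := by linarith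
  simp only at hanti
  subst ham
  nlinarith

lemma one_sub_corr {a b x : ℝ} (hx : 0 < x) :
    1 - corr a b x = (1 - incBeta a b x / Beta (a + 1) (b + 1)
      - (1 - x ^ ((1 + a + b) / 2)) ^ 2) / (2 * x ^ ((1 + a + b) / 2)) := by
  have h := rpow_pos_of_pos hx ((1 + a + b) / 2)
  rw [corr, rpow_neg hx.le]
  generalize incBeta a b x / Beta (a + 1) (b + 1) = I
  field_simp
  ring

lemma corr_nonneg {a b x : ℝ} (ha : -1 < a) (hb : -1 < b) (hx : x ∈ Icc (0:ℝ) 1) :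
    0 ≤ corr a b x := by
  have := incBeta_nonneg (a := a) (b := b) hx
  have := Beta_pos ha hb
  have := rpow_nonneg hx.1 ((1 + a + b) / 2)
  have := rpow_nonneg hx.1 (-((1 + a + b) / 2))
  unfold corr
  positivity

lemma corr_lt_one {a b x : ℝ} (ha : -1 < a) (hb1 : |b| < 1) (hb2 : |b| < 1 + a)
    (hx : x ∈ Ioo (0:ℝ) 1) : corr a b x < 1 := by
  have h := rpow_pos_of_pos hx.1 ((1 + a + b) / 2)
  have : 0 < 1 - corr a b x := by
    rw [one_sub_corr hx.1]
    exact div_pos (by linarith [gap_pos ha hb1 hb2 hx]) (by positivity)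
  linarith

lemma continuousOn_corr {a b : ℝ} (ha : -1 < a) (hb : -1 < b) :
    ContinuousOn (corr a b) (Ioc 0 1) := by
  have h1 := (continuousOn_incBeta ha hb).mono Ioc_subset_Icc_self
  have h2 : ∀ p : ℝ, ContinuousOn (fun x : ℝ => x ^ p) (Ioc 0 1) := fun p =>
    continuousOn_id.rpow_const fun x hx => Or.inl hx.1.ne'
  exact ((h2 _).add ((h2 _).mul (h1.div_const _))).div_const 2

lemma corr_one {a b : ℝ} (ha : -1 < a) (hb : -1 < b) : corr a b 1 = 1 := by
  simp [corr, incBeta_one ha hb, (Beta_pos ha hb).ne']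

lemma tendsto_corr_zero {a b : ℝ} (ha : -1 < a) (hb1 : |b| < 1) (hb2 : |b| < 1 + a) :
    Tendsto (corr a b) (𝓝[>] 0) (𝓝 0) := by
  have hb := abs_lt.1 hb1
  have hb' := abs_lt.1 hb2
  obtain ⟨m, hmdef⟩ : ∃ m, m = (1 + a + b) / 2 := ⟨_, rfl⟩
  have hm : 0 < m := by linarith
  have hpow : ∀ p : ℝ, 0 < p → Tendsto (fun x : ℝ => x ^ p) (𝓝[>] 0) (𝓝 0) := by
    intro p hp
    have := (continuousAt_rpow_const 0 p (Or.inr hp.le)).tendsto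
    rw [zero_rpow hp.ne'] at this
    exact this.mono_left nhdsWithin_le_nhds
  have hI0 : Tendsto (incBeta a b) (𝓝[>] 0) (𝓝 0) := by
    have := (continuousOn_incBeta ha hb.1) 0 (by simp)
    rw [ContinuousWithinAt, incBeta_zero] at this
    rw [← nhdsWithin_Ioo_eq_nhdsGT zero_lt_one]
    exact this.mono_left (nhdsWithin_mono _ Ioo_subset_Icc_self)
  have hI : Tendsto (fun x => incBeta a b x / x ^ m) (𝓝[>] 0) (𝓝 0) := by
    refine HasDerivAt.lhopital_zero_right_on_Ioo zero_lt_one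
      (fun x hx => hasDerivAt_incBeta ha hb.1 hx)
      (fun x hx => hasDerivAt_rpow_const (Or.inl hx.1.ne')) ?_ hI0 (hpow m hm) ?_
    · intro x hx
      exact mul_ne_zero hm.ne' (rpow_pos_of_pos hx.1 _).ne'
    · have h1 : Tendsto (fun x : ℝ => x ^ (a + 1 - m) * (1 - x) ^ b / m) (𝓝[>] 0)
          (𝓝 (0 * (1 - 0) ^ b / m)) := by
        refine ((hpow _ (by linarith)).mul ?_).div_const m
        have : ContinuousAt (fun x : ℝ => (1 - x) ^ b) 0 :=
          ContinuousAt.rpow_const (by fun_prop) (Or.inl (by norm_num))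
        exact this.tendsto.mono_left nhdsWithin_le_nhds
      rw [zero_mul, zero_div] at h1
      refine h1.congr' ?_
      filter_upwards [self_mem_nhdsWithin] with x hx
      have hx : 0 < x := hx
      rw [show a + 1 - m = a - (m - 1) by ring, rpow_sub hx]
      have := rpow_pos_of_pos hx (m - 1)
      field_simp
  have h := ((hpow m hm).add (hI.div_const (Beta (a + 1) (b + 1)))).div_const 2
  simp only [zero_div, add_zero] at h
  refine h.congr' ?_
  filter_upwards [self_mem_nhdsWithin] with x hx
  have hx : 0 < x := hx
  rw [corr, ← hmdef, rpow_neg hx.le]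
  ring

lemma tendsto_one_sub_corr_div {a b : ℝ} (ha : -1 < a) (hb1 : |b| < 1) :
    Tendsto (fun x => (1 - corr a b x) / (1 - x) ^ (1 + b)) (𝓝[<] 1)
      (𝓝 (1 / (2 * (Beta (a + 1) (b + 1) * (1 + b))))) := by
  have hb := abs_lt.1 hb1
  have hB := Beta_pos ha hb.1
  set B := Beta (a + 1) (b + 1) with hBdef
  obtain ⟨m, hmdef⟩ : ∃ m, m = (1 + a + b) / 2 := ⟨_, rfl⟩
  have hcont : ∀ p : ℝ, Tendsto (fun x : ℝ => x ^ p) (𝓝[<] 1) (𝓝 1) := by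
    intro p
    have := (continuousAt_rpow_const 1 p (Or.inl one_ne_zero)).tendsto
    rw [one_rpow] at this
    exact this.mono_left nhdsWithin_le_nhds
  have hpow : ∀ p : ℝ, 0 < p → Tendsto (fun x : ℝ => (1 - x) ^ p) (𝓝[<] 1) (𝓝 0) := by
    intro p hp
    have : ContinuousAt (fun x : ℝ => (1 - x) ^ p) 1 :=
      ContinuousAt.rpow_const (by fun_prop) (Or.inr hp.le)
    have := this.tendsto
    rw [sub_self, zero_rpow hp.ne'] at this
    exact this.mono_left nhdsWithin_le_nhds
  have hI0 : Tendsto (fun x => 1 - incBeta a b x / B) (𝓝[<] 1) (𝓝 0) := by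
    have := (continuousOn_incBeta ha hb.1) 1 (by simp)
    rw [ContinuousWithinAt, incBeta_one ha hb.1, ← hBdef] at this
    have := (this.div_const B).const_sub 1
    rw [div_self hB.ne', sub_self] at this
    rw [← nhdsWithin_Ioo_eq_nhdsLT zero_lt_one]
    exact this.mono_left (nhdsWithin_mono _ Ioo_subset_Icc_self)
  have hI : Tendsto (fun x => (1 - incBeta a b x / B) / (1 - x) ^ (1 + b)) (𝓝[<] 1)
      (𝓝 (1 / (B * (1 + b)))) := by
    refine HasDerivAt.lhopital_zero_left_on_Ioo zero_lt_one
      (f' := fun x => -(x ^ a * (1 - x) ^ b / B)) (g' := fun x => -1 * (1 + b) * (1 - x) ^ (1 + b - 1))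
      (fun x hx => ((hasDerivAt_incBeta ha hb.1 hx).div_const B).const_sub 1)
      (fun x hx => ?_) ?_ hI0 (hpow _ (by linarith)) ?_
    · exact ((hasDerivAt_id x).const_sub 1).rpow_const
        (Or.inl (by simpa using (by linarith [hx.2] : (0:ℝ) < 1 - x).ne'))
    · intro x hx
      have := rpow_pos_of_pos (by linarith [hx.2] : (0:ℝ) < 1 - x) (1 + b - 1)
      exact mul_ne_zero (by linarith) this.ne'
    · refine ((hcont a).div_const (B * (1 + b))).congr' ?_
      filter_upwards [self_mem_nhdsWithin] with x hx
      have hx : x < 1 := hx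
      have := rpow_pos_of_pos (by linarith : (0:ℝ) < 1 - x) b
      rw [show 1 + b - 1 = b by ring]
      have h1b : 0 < 1 + b := by linarith
      field_simp
  have hsq : Tendsto (fun x : ℝ => ((1 - x ^ m) / (1 - x)) ^ 2 * (1 - x) ^ (1 - b)) (𝓝[<] 1)
      (𝓝 (m ^ 2 * 0)) := by
    refine Tendsto.mul (Tendsto.pow ?_ 2) (hpow _ (by linarith))
    have := (hasDerivAt_rpow_const (x := 1) (p := m) (Or.inl one_ne_zero)).tendsto_slope
    rw [one_rpow, mul_one] at this
    refine (this.mono_left (nhdsWithin_mono _ fun x (hx : x < 1) => hx.ne)).congr ?_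
    intro x
    rw [slope_def_field, one_rpow, ← neg_div_neg_eq, neg_sub, neg_sub]
  have h := (hI.sub hsq).div ((hcont m).const_mul 2) (by norm_num)
  have hlim : (1 / (B * (1 + b)) - m ^ 2 * 0) / (2 * 1) = 1 / (2 * (B * (1 + b))) := by
    have h1b : 0 < 1 + b := by linarith
    field_simp
    ring
  rw [hlim] at h
  refine h.congr' ?_
  filter_upwards [Ioo_mem_nhdsLT zero_lt_one] with x hx
  have hx1 : 0 < 1 - x := by linarith [hx.2]
  rw [one_sub_corr hx.1, ← hmdef, ← hBdef, Pi.div_apply]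
  have h1 := rpow_pos_of_pos hx1 (1 + b)
  have h2 := rpow_pos_of_pos hx.1 m
  have h3 : (1 - x) ^ (1 - b) = (1 - x) ^ 2 / (1 - x) ^ (1 + b) := by
    rw [show 1 - b = 2 - (1 + b) by ring, rpow_sub hx1, rpow_two]
  rw [h3]
  field_simp

lemma ContinuousOn.exists_pos_bounds_of_tendsto {f : ℝ → ℝ} {u v lu lv : ℝ} (huv : u < v)
    (hf : ContinuousOn f (Ioo u v)) (hpos : ∀ x ∈ Ioo u v, 0 < f x)
    (hlu : 0 < lu) (hlv : 0 < lv) (hu : Tendsto f (𝓝[>] u) (𝓝 lu))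
    (hv : Tendsto f (𝓝[<] v) (𝓝 lv)) :
    ∃ c > (0:ℝ), ∃ C > (0:ℝ), ∀ x ∈ Ioo u v, c ≤ f x ∧ f x ≤ C := by
  have hg := continuousOn_Icc_extendFrom_Ioo hf hu hv
  have heq : ∀ x ∈ Ioo u v, extendFrom (Ioo u v) f x = f x := fun x hx =>
    extendFrom_extends hf x hx
  have hgpos : ∀ x ∈ Icc u v, 0 < extendFrom (Ioo u v) f x := by
    intro x hx
    rcases eq_or_lt_of_le hx.1 with rfl | h1
    · rwa [eq_lim_at_left_extendFrom_Ioo huv hu]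
    rcases eq_or_lt_of_le hx.2 with rfl | h2
    · rwa [eq_lim_at_right_extendFrom_Ioo huv hv]
    rw [heq x ⟨h1, h2⟩]
    exact hpos x ⟨h1, h2⟩
  have hne : (Icc u v).Nonempty := nonempty_Icc.2 huv.le
  obtain ⟨p, hp, hpmin⟩ := isCompact_Icc.exists_isMinOn hne hg
  obtain ⟨q, hq, hqmax⟩ := isCompact_Icc.exists_isMaxOn hne hg
  refine ⟨_, hgpos p hp, _, hgpos q hq, fun x hx => ?_⟩
  rw [← heq x hx]
  exact ⟨hpmin (Ioo_subset_Icc_self hx), hqmax (Ioo_subset_Icc_self hx)⟩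

lemma exists_bounds_one_sub_corr_sq {a b : ℝ} (ha : -1 < a) (hb1 : |b| < 1) (hb2 : |b| < 1 + a) :
    ∃ c > (0:ℝ), ∃ C > (0:ℝ), ∀ x ∈ Ioo (0:ℝ) 1,
      c * (1 - x) ^ (1 + b) ≤ 1 - corr a b x ^ 2 ∧
        1 - corr a b x ^ 2 ≤ C * (1 - x) ^ (1 + b) := by
  have hb := abs_lt.1 hb1
  have hB := Beta_pos ha hb.1
  have h1b : 0 < 1 + b := by linarith
  have hcorr := continuousOn_corr ha hb.1
  have hpow : ∀ x ∈ Ioo (0:ℝ) 1, 0 < (1 - x) ^ (1 + b) := fun x hx =>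
    rpow_pos_of_pos (by linarith [hx.2]) _
  suffices key : ∃ c > (0:ℝ), ∃ C > (0:ℝ), ∀ x ∈ Ioo (0:ℝ) 1,
      c ≤ (1 - corr a b x ^ 2) / (1 - x) ^ (1 + b) ∧
        (1 - corr a b x ^ 2) / (1 - x) ^ (1 + b) ≤ C by
    obtain ⟨c, hc, C, hC, h⟩ := key
    refine ⟨c, hc, C, hC, fun x hx => ?_⟩
    obtain ⟨h1, h2⟩ := h x hx
    exact ⟨(le_div_iff₀ (hpow x hx)).1 h1, (div_le_iff₀ (hpow x hx)).1 h2⟩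
  refine ContinuousOn.exists_pos_bounds_of_tendsto
    (f := fun x => (1 - corr a b x ^ 2) / (1 - x) ^ (1 + b)) (u := 0) (v := 1) (lu := 1)
    (lv := (1 + 1) * (1 / (2 * (Beta (a + 1) (b + 1) * (1 + b))))) zero_lt_one ?_ ?_ one_pos
    (by positivity) ?_ ?_
  · refine (continuousOn_const.sub ((hcorr.mono Ioo_subset_Ioc_self).pow 2)).div ?_
      (fun x hx => (hpow x hx).ne')
    exact ContinuousOn.rpow_const (by fun_prop) fun _ _ => Or.inr h1b.le
  · intro x hx
    refine div_pos ?_ (hpow x hx)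
    nlinarith [corr_lt_one ha hb1 hb2 hx, corr_nonneg ha hb.1 (Ioo_subset_Icc_self hx)]
  · have h1 := ((tendsto_corr_zero ha hb1 hb2).pow 2).const_sub 1
    have h2 : ContinuousAt (fun x : ℝ => (1 - x) ^ (1 + b)) 0 :=
      ContinuousAt.rpow_const (by fun_prop) (Or.inr h1b.le)
    have h3 := h1.div (h2.tendsto.mono_left nhdsWithin_le_nhds) (by simp)
    simpa using! h3
  · have h1 : Tendsto (corr a b) (𝓝[<] 1) (𝓝 1) := by
      have := hcorr 1 (by simp)
      rw [ContinuousWithinAt, corr_one ha hb.1] at this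
      rw [← nhdsWithin_Ioo_eq_nhdsLT zero_lt_one]
      exact this.mono_left (nhdsWithin_mono _ Ioo_subset_Ioc_self)
    refine ((h1.const_add 1).mul (tendsto_one_sub_corr_div ha hb1)).congr fun x => ?_
    ring

lemma R_comm (a b t s : ℝ) : R a b t s = R a b s t := by
  simp only [R, min_comm t s, add_comm ((t - _) ^ b)]

theorem stmt_2 (a b : ℝ) (ha : -1 < a) (hb1 : |b| < 1) (hb2 : |b| < 1 + a) :
    ∃ c > (0:ℝ), ∃ C > (0:ℝ), ∀ s t : ℝ, 0 < s → 0 < t →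
      c * (t * s) ^ a * (min t s) ^ (1 + b) * |t - s| ^ (1 + b) ≤
          t ^ (1 + a + b) * s ^ (1 + a + b) - (R a b t s) ^ 2 ∧
        t ^ (1 + a + b) * s ^ (1 + a + b) - (R a b t s) ^ 2 ≤
          C * (t * s) ^ a * (min t s) ^ (1 + b) * |t - s| ^ (1 + b) := by
  obtain ⟨c, hc, C, hC, h⟩ := exists_bounds_one_sub_corr_sq ha hb1 hb2
  have hb := abs_lt.1 hb1
  refine ⟨c, hc, C, hC, ?_⟩
  have ordered : ∀ s t : ℝ, 0 < s → s ≤ t →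
      c * (t * s) ^ a * (min t s) ^ (1 + b) * |t - s| ^ (1 + b) ≤
          t ^ (1 + a + b) * s ^ (1 + a + b) - (R a b t s) ^ 2 ∧
        t ^ (1 + a + b) * s ^ (1 + a + b) - (R a b t s) ^ 2 ≤
          C * (t * s) ^ a * (min t s) ^ (1 + b) * |t - s| ^ (1 + b) := by
    intro s t hs hst
    have ht : 0 < t := hs.trans_le hst
    have hgap : t ^ (1 + a + b) * s ^ (1 + a + b) - (R a b t s) ^ 2 =
        t ^ (1 + a + b) * s ^ (1 + a + b) * (1 - corr a b (s / t) ^ 2) := by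
      rw [R_eq_mul_corr ha hb.1 hs hst, mul_pow, mul_pow, ← rpow_mul_natCast ht.le,
        ← rpow_mul_natCast hs.le]
      push_cast
      rw [div_mul_cancel₀ _ two_ne_zero]
      ring
    rcases eq_or_lt_of_le hst with rfl | hlt
    · rw [hgap, div_self hs.ne', corr_one ha hb.1, sub_self, abs_zero,
        zero_rpow (by linarith)]
      simp
    have hx : s / t ∈ Ioo (0:ℝ) 1 := ⟨by positivity, (div_lt_one ht).2 hlt⟩
    have hx1 : 0 ≤ 1 - s / t := by linarith [hx.2]
    have hN : 0 ≤ t ^ (1 + a + b) * s ^ (1 + a + b) := by positivity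
    have hscale : ∀ K : ℝ, K * (t * s) ^ a * (min t s) ^ (1 + b) * |t - s| ^ (1 + b) =
        t ^ (1 + a + b) * s ^ (1 + a + b) * (K * (1 - s / t) ^ (1 + b)) := by
      intro K
      rw [min_eq_right hst, abs_of_pos (by linarith),
        show t - s = t * (1 - s / t) by field_simp, mul_rpow ht.le hx1, mul_rpow ht.le hs.le,
        show 1 + a + b = a + (1 + b) by ring, rpow_add ht a, rpow_add hs a]
      ring
    rw [hgap, hscale, hscale]
    exact ⟨mul_le_mul_of_nonneg_left (h _ hx).1 hN, mul_le_mul_of_nonneg_left (h _ hx).2 hN⟩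
  intro s t hs ht
  rcases le_total s t with hst | hst
  · exact ordered s t hs hst
  · have := ordered t s ht hst
    rwa [mul_comm s t, min_comm s t, abs_sub_comm s t, R_comm a b s t,
      mul_comm (s ^ (1 + a + b))] at this
end

section
/- Let a, b be real numbers with a > -1, -1 < b < 0 and |b| < 1 + a, and let α ∈ [0,1]. Then there exists a constant C > 0, depending only on a, b, α, such that for all t > s > t' > s' > 0: (1/(2Β(a+1,b+1))) ∫_{s'}^{t'} u^a ((s-u)^b - (t-u)^b) du ≤ C · (max((s')^a, s^a))^α · (t·t')^{a(1-α)/2} · ((t-s)(t'-s'))^{(1+b)(1+α)/2} · (t-t')^{-(1+b)α}. -/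
open Real MeasureTheory

open intervalIntegral in
theorem integral_sub_rpow {b : ℝ} (hb : -1 < b) (c x y : ℝ) :
    ∫ u in x..y, (c - u) ^ b = ((c - x) ^ (1 + b) - (c - y) ^ (1 + b)) / (1 + b) := by
  rw [integral_comp_sub_left (fun v => v ^ b), integral_rpow (Or.inl hb), add_comm b 1]

theorem intervalIntegrable_sub_rpow {b : ℝ} (hb : -1 < b) (c x y : ℝ) :
    IntervalIntegrable (fun u : ℝ => (c - u) ^ b) volume x y := by
  simpa using (intervalIntegral.intervalIntegrable_rpow' hb (a := c - x) (b := c - y)).comp_sub_left c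

theorem continuousOn_sub_rpow (b : ℝ) {c x y : ℝ} (hxy : x ≤ y) (hyc : y < c) :
    ContinuousOn (fun u : ℝ => (c - u) ^ b) (Set.uIcc x y) := by
  rw [Set.uIcc_of_le hxy]
  refine ContinuousOn.rpow_const (by fun_prop) fun u hu => Or.inl ?_
  have := hu.2
  exact (by linarith : (0 : ℝ) < c - u).ne'

theorem continuousOn_rpow_uIcc (a : ℝ) {x y : ℝ} (hx : 0 < x) (hxy : x ≤ y) :
    ContinuousOn (fun u : ℝ => u ^ a) (Set.uIcc x y) := by
  rw [Set.uIcc_of_le hxy]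
  exact ContinuousOn.rpow_const (by fun_prop) fun u hu => Or.inl (hx.trans_le hu.1).ne'

theorem intervalIntegrable_beta_kernel {a b : ℝ} (ha : -1 < a) (hb : -1 < b) {t : ℝ} (ht : 0 < t) :
    IntervalIntegrable (fun u : ℝ => u ^ a * (t - u) ^ b) volume 0 t := by
  refine IntervalIntegrable.trans (b := t / 2) ?_ ?_
  · exact (intervalIntegral.intervalIntegrable_rpow' ha).mul_continuousOn
      (continuousOn_sub_rpow b (by linarith) (by linarith))
  · exact (intervalIntegrable_sub_rpow hb t _ _).continuousOn_mul
      (continuousOn_rpow_uIcc a (by linarith) (by linarith))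

theorem integral_beta_kernel_scaled (a b : ℝ) {t : ℝ} (ht : 0 < t) :
    ∫ u in (0 : ℝ)..t, u ^ a * (t - u) ^ b =
      t ^ (a + (1 + b)) * ∫ u in (0 : ℝ)..1, u ^ a * (1 - u) ^ b := by
  have h := intervalIntegral.smul_integral_comp_mul_left (a := 0) (b := 1)
    (fun u : ℝ => u ^ a * (t - u) ^ b) t
  rw [mul_zero, mul_one] at h
  rw [← h, smul_eq_mul, ← intervalIntegral.integral_const_mul, ← intervalIntegral.integral_const_mul]
  refine intervalIntegral.integral_congr fun u hu => ?_
  rw [Set.uIcc_of_le zero_le_one] at hu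
  have h1 : t - t * u = t * (1 - u) := by ring
  simp only [h1]
  rw [mul_rpow ht.le hu.1, mul_rpow ht.le (by linarith [hu.2]), rpow_add ht, rpow_add ht, rpow_one]
  ring

theorem beta_kernel_nonneg (a b : ℝ) {t u : ℝ} (hu : 0 ≤ u) (hut : u ≤ t) :
    0 ≤ u ^ a * (t - u) ^ b :=
  mul_nonneg (rpow_nonneg hu _) (rpow_nonneg (by linarith) _)

theorem integral_beta_kernel_mono {a b : ℝ} (hab : 0 ≤ a + (1 + b)) {s t : ℝ} (hs : 0 < s)
    (hst : s ≤ t) :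
    ∫ u in (0 : ℝ)..s, u ^ a * (s - u) ^ b ≤ ∫ u in (0 : ℝ)..t, u ^ a * (t - u) ^ b := by
  rw [integral_beta_kernel_scaled a b hs, integral_beta_kernel_scaled a b (hs.trans_le hst)]
  gcongr
  exact intervalIntegral.integral_nonneg zero_le_one fun u hu => beta_kernel_nonneg a b hu.1 hu.2

/-- The incomplete Beta integral over `[s, t]` is controlled by `t ^ a * (t - s) ^ (1 + b)`. -/
theorem exists_integral_beta_kernel_le {a b : ℝ} (ha : -1 < a) (hb : -1 < b) :
    ∃ K > (0 : ℝ), ∀ s t : ℝ, 0 < s → s < t →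
      ∫ u in s..t, u ^ a * (t - u) ^ b ≤ K * (t ^ a * (t - s) ^ (1 + b)) := by
  have hβ : 0 < 1 + b := by linarith
  set G := ∫ u in (0 : ℝ)..1, u ^ a * (1 - u) ^ b
  have hG0 : 0 ≤ G :=
    intervalIntegral.integral_nonneg zero_le_one fun u hu => beta_kernel_nonneg a b hu.1 hu.2
  refine ⟨(1 + 2⁻¹ ^ a) / (1 + b) + 2 ^ (1 + b) * G, by positivity, fun s t hs hst => ?_⟩
  have ht : 0 < t := hs.trans hst
  have hts : 0 < t - s := sub_pos.2 hst
  have hint := intervalIntegrable_beta_kernel ha hb ht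
  rcases le_or_gt (2⁻¹ * t) s with h | h
  · have hpt : ∀ u ∈ Set.Ioo s t,
        u ^ a * (t - u) ^ b ≤ (1 + 2⁻¹ ^ a) * t ^ a * (t - u) ^ b := by
      intro u hu
      have hu0 : 0 < u := hs.trans hu.1
      refine mul_le_mul_of_nonneg_right ?_ (rpow_nonneg (by linarith [hu.2]) _)
      rcases le_or_gt 0 a with ha0 | ha0
      · calc u ^ a ≤ t ^ a := rpow_le_rpow hu0.le hu.2.le ha0
          _ ≤ _ := by
            have : 0 ≤ (2⁻¹ : ℝ) ^ a * t ^ a := by positivity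
            linarith
      · calc u ^ a ≤ (2⁻¹ * t) ^ a :=
              rpow_le_rpow_of_nonpos (by positivity) (h.trans hu.1.le) ha0.le
          _ = 2⁻¹ ^ a * t ^ a := mul_rpow (by norm_num) ht.le
          _ ≤ _ := by
            have : 0 ≤ t ^ a := by positivity
            linarith
    calc ∫ u in s..t, u ^ a * (t - u) ^ b
        ≤ ∫ u in s..t, (1 + 2⁻¹ ^ a) * t ^ a * (t - u) ^ b := by
          refine intervalIntegral.integral_mono_on_of_le_Ioo hst.le ?_ ?_ hpt
          · exact (intervalIntegrable_sub_rpow hb t _ _).continuousOn_mul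
              (continuousOn_rpow_uIcc a hs hst.le)
          · exact (intervalIntegrable_sub_rpow hb t _ _).const_mul _
      _ = (1 + 2⁻¹ ^ a) / (1 + b) * (t ^ a * (t - s) ^ (1 + b)) := by
          rw [intervalIntegral.integral_const_mul, integral_sub_rpow hb, sub_self,
            zero_rpow hβ.ne']
          ring
      _ ≤ _ := by
          gcongr
          have : 0 ≤ 2 ^ (1 + b) * G := by positivity
          linarith
  · calc ∫ u in s..t, u ^ a * (t - u) ^ b
        ≤ ∫ u in (0 : ℝ)..t, u ^ a * (t - u) ^ b := by
          refine intervalIntegral.integral_mono_interval hs.le hst.le le_rfl ?_ hint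
          exact (ae_restrict_iff' measurableSet_Ioc).2
            (.of_forall fun u hu => beta_kernel_nonneg a b hu.1.le hu.2)
      _ = t ^ a * t ^ (1 + b) * G := by rw [integral_beta_kernel_scaled a b ht, rpow_add ht]
      _ ≤ t ^ a * (2 * (t - s)) ^ (1 + b) * G := by
          gcongr
          linarith
      _ = 2 ^ (1 + b) * G * (t ^ a * (t - s) ^ (1 + b)) := by
          rw [mul_rpow (by norm_num) hts.le]
          ring
      _ ≤ _ := by
          gcongr
          have : 0 ≤ (1 + (2⁻¹ : ℝ) ^ a) / (1 + b) := by positivity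
          linarith

theorem intervalIntegrable_increment_kernel (a b : ℝ) {t s t' s' : ℝ} (h0 : 0 < s')
    (h1 : s' ≤ t') (h2 : t' < s) (h3 : s < t) :
    IntervalIntegrable (fun u : ℝ => u ^ a * ((s - u) ^ b - (t - u) ^ b)) volume s' t' :=
  ((continuousOn_rpow_uIcc a h0 h1).mul ((continuousOn_sub_rpow b h1 h2).sub
    (continuousOn_sub_rpow b h1 (h2.trans h3)))).intervalIntegrable

theorem increment_kernel_nonneg (a : ℝ) {b t s u : ℝ} (hb : b ≤ 0) (hu : 0 ≤ u) (hus : u < s)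
    (hst : s ≤ t) : 0 ≤ u ^ a * ((s - u) ^ b - (t - u) ^ b) :=
  mul_nonneg (rpow_nonneg hu _) (sub_nonneg.2
    (rpow_le_rpow_of_nonpos (by linarith) (by linarith) hb))

/-- The past increment dominates: drop the subtracted term and move the singularity to `t'`. -/
theorem integral_increment_kernel_le_past (a : ℝ) {b t s t' s' : ℝ} (hb : -1 < b) (hb0 : b ≤ 0)
    (h0 : 0 < s') (h1 : s' < t') (h2 : t' < s) (h3 : s < t) :
    ∫ u in s'..t', u ^ a * ((s - u) ^ b - (t - u) ^ b) ≤
      ∫ u in s'..t', u ^ a * (t' - u) ^ b := by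
  refine intervalIntegral.integral_mono_on_of_le_Ioo h1.le
    (intervalIntegrable_increment_kernel a b h0 h1.le h2 h3)
    ((intervalIntegrable_sub_rpow hb t' _ _).continuousOn_mul
      (continuousOn_rpow_uIcc a h0 h1.le)) fun u hu => ?_
  refine mul_le_mul_of_nonneg_left ?_ (rpow_nonneg (h0.trans hu.1).le _)
  have hA : (s - u) ^ b ≤ (t' - u) ^ b :=
    rpow_le_rpow_of_nonpos (by linarith [hu.2]) (by linarith) hb0
  have hB : 0 ≤ (t - u) ^ b := rpow_nonneg (by linarith [hu.2]) _
  linarith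

/-- The future increment dominates: extend to `[0, s]` and use that the complete integral
is nondecreasing in its endpoint. -/
theorem integral_increment_kernel_le_future {a b t s t' s' : ℝ} (ha : -1 < a) (hb : -1 < b)
    (hb0 : b ≤ 0) (hab : 0 ≤ a + (1 + b))
    (h0 : 0 < s') (h1 : s' < t') (h2 : t' < s) (h3 : s < t) :
    ∫ u in s'..t', u ^ a * ((s - u) ^ b - (t - u) ^ b) ≤
      ∫ u in s..t, u ^ a * (t - u) ^ b := by
  have hs : 0 < s := by linarith
  have hfs := intervalIntegrable_beta_kernel ha hb hs
  have hft := intervalIntegrable_beta_kernel ha hb (hs.trans h3)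
  have hft1 : IntervalIntegrable (fun u : ℝ => u ^ a * (t - u) ^ b) volume 0 s :=
    hft.mono_set (by
      rw [Set.uIcc_of_le hs.le, Set.uIcc_of_le (hs.trans h3).le]
      exact Set.Icc_subset_Icc_right h3.le)
  have hft2 : IntervalIntegrable (fun u : ℝ => u ^ a * (t - u) ^ b) volume s t := hft1.symm.trans hft
  have hsub := hfs.sub hft1
  calc ∫ u in s'..t', u ^ a * ((s - u) ^ b - (t - u) ^ b)
      = ∫ u in s'..t', (u ^ a * (s - u) ^ b - u ^ a * (t - u) ^ b) := by simp only [mul_sub]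
    _ ≤ ∫ u in (0 : ℝ)..s, (u ^ a * (s - u) ^ b - u ^ a * (t - u) ^ b) := by
        refine intervalIntegral.integral_mono_interval h0.le h1.le h2.le ?_ hsub
        refine (ae_restrict_iff' measurableSet_Ioc).2 ?_
        filter_upwards [compl_mem_ae_iff.2 (measure_singleton s)] with u hus hu
        have := increment_kernel_nonneg a hb0 hu.1.le (lt_of_le_of_ne hu.2 hus) h3.le
        rwa [mul_sub] at this
    _ = (∫ u in (0 : ℝ)..s, u ^ a * (s - u) ^ b) - ∫ u in (0 : ℝ)..s, u ^ a * (t - u) ^ b :=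
        intervalIntegral.integral_sub hfs hft1
    _ ≤ (∫ u in (0 : ℝ)..t, u ^ a * (t - u) ^ b) - ∫ u in (0 : ℝ)..s, u ^ a * (t - u) ^ b :=
        sub_le_sub_right (integral_beta_kernel_mono hab hs h3.le) _
    _ = ∫ u in s..t, u ^ a * (t - u) ^ b := by
        rw [← intervalIntegral.integral_add_adjacent_intervals hft1 hft2]
        ring

theorem rpow_sub_rpow_add_le {b w x : ℝ} (hb : -1 ≤ b) (hw : 0 < w) (hx : 0 ≤ x) :
    w ^ b - (w + x) ^ b ≤ x * w ^ (b - 1) := by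
  have h1 : (w + x) ^ b = w ^ b * (1 + x / w) ^ b := by
    rw [← mul_rpow hw.le (by positivity)]
    congr 1
    field_simp
  have h2 : (1 + x / w) ^ (-1 : ℝ) ≤ (1 + x / w) ^ b :=
    rpow_le_rpow_of_exponent_le (by linarith [div_nonneg hx hw.le]) hb
  have h3 : 1 - x / w ≤ (1 + x / w) ^ (-1 : ℝ) := by
    have : 0 ≤ x / w := by positivity
    rw [rpow_neg_one, ← one_div, le_div_iff₀ (by positivity)]
    nlinarith
  have h4 : 0 ≤ w ^ b := by positivity
  rw [h1, rpow_sub_one hw.ne']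
  calc w ^ b - w ^ b * (1 + x / w) ^ b = w ^ b * (1 - (1 + x / w) ^ b) := by ring
    _ ≤ w ^ b * (x / w) := by gcongr; linarith
    _ = x * (w ^ b / w) := by ring

/-- The increment bound for the unweighted kernel. -/
theorem integral_sub_rpow_sub_rpow_le {b t s t' s' : ℝ} (hb : -1 < b) (hb0 : b ≤ 0)
    (h1 : s' < t') (h2 : t' < s) (h3 : s < t) :
    ∫ u in s'..t', ((s - u) ^ b - (t - u) ^ b) ≤
      2 ^ (1 + b) / (1 + b) * (((t - s) * (t' - s')) ^ (1 + b) * (t - t') ^ (-(1 + b))) := by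
  have hβ : 0 < 1 + b := by linarith
  obtain ⟨x, hx, rfl⟩ : ∃ x, 0 < x ∧ t = s + x := ⟨t - s, by linarith, by ring⟩
  obtain ⟨y, hy, rfl⟩ : ∃ y, 0 < y ∧ t' = s' + y := ⟨t' - s', by linarith, by ring⟩
  obtain ⟨z, hz, rfl⟩ : ∃ z, 0 < z ∧ s = s' + y + z := ⟨s - (s' + y), by linarith, by ring⟩
  have hi1 := (continuousOn_sub_rpow b h1.le h2).intervalIntegrable (μ := volume)
  have hi2 := (continuousOn_sub_rpow b h1.le (h2.trans h3)).intervalIntegrable (μ := volume)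
  set J := ∫ u in s'..(s' + y), ((s' + y + z - u) ^ b - (s' + y + z + x - u) ^ b) with hJ
  have hJeq : J = ((y + z) ^ (1 + b) - z ^ (1 + b) - (y + z + x) ^ (1 + b)
      + (z + x) ^ (1 + b)) / (1 + b) := by
    rw [hJ, intervalIntegral.integral_sub hi1 hi2, integral_sub_rpow hb, integral_sub_rpow hb]
    ring_nf
  have hle : 1 + b ≤ 1 := by linarith
  have hJy : J ≤ y ^ (1 + b) / (1 + b) := by
    rw [hJeq]
    gcongr
    have e1 := rpow_add_le_add_rpow hy.le hz.le hβ.le hle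
    have e2 : (z + x) ^ (1 + b) ≤ (y + z + x) ^ (1 + b) := by gcongr; linarith
    linarith
  have hJx : J ≤ x ^ (1 + b) / (1 + b) := by
    rw [hJeq]
    gcongr
    have e1 := rpow_add_le_add_rpow hz.le hx.le hβ.le hle
    have e2 : (y + z) ^ (1 + b) ≤ (y + z + x) ^ (1 + b) :=
      rpow_le_rpow (by positivity) (by linarith) hβ.le
    linarith
  have hJz : J ≤ y * (x * z ^ (b - 1)) := by
    calc J ≤ ∫ u in s'..(s' + y), x * z ^ (b - 1) := by
          refine intervalIntegral.integral_mono_on h1.le (hi1.sub hi2) (by simp) fun u hu => ?_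
          have hw : z ≤ s' + y + z - u := by linarith [hu.2]
          have e := rpow_sub_rpow_add_le hb.le (hz.trans_le hw) hx.le
          rw [show s' + y + z - u + x = s' + y + z + x - u by ring] at e
          refine e.trans ?_
          gcongr ?_ * ?_
          exact rpow_le_rpow_of_nonpos hz hw (by linarith)
      _ = _ := by
          rw [intervalIntegral.integral_const, smul_eq_mul]
          ring
  have hgoal : 2 ^ (1 + b) / (1 + b) * (((s' + y + z + x - (s' + y + z)) * (s' + y - s')) ^ (1 + b)
      * (s' + y + z + x - (s' + y)) ^ (-(1 + b))) = (2 * (x * y / (z + x))) ^ (1 + b) / (1 + b) := by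
    rw [show s' + y + z + x - (s' + y + z) = x by ring, show s' + y - s' = y by ring,
      show s' + y + z + x - (s' + y) = z + x by ring, mul_rpow zero_le_two (by positivity),
      div_rpow (by positivity) (by positivity), rpow_neg (by positivity)]
    ring
  rw [hgoal]
  rcases le_or_gt z x with hzx | hzx
  · refine hJy.trans ?_
    gcongr
    rw [← mul_div_assoc, le_div_iff₀ (by positivity)]
    nlinarith
  rcases le_or_gt z y with hzy | hzy
  · refine hJx.trans ?_
    gcongr
    rw [← mul_div_assoc, le_div_iff₀ (by positivity)]
    nlinarith
  calc J ≤ y * (x * z ^ (b - 1)) := hJz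
    _ = (x * y / z ^ 2) * z ^ (1 + b) := by
        rw [show b - 1 = 1 + b - 2 by ring, rpow_sub hz, rpow_two]
        ring
    _ ≤ (x * y / z ^ 2) ^ (1 + b) * z ^ (1 + b) := by
        gcongr
        refine self_le_rpow_of_le_one (by positivity) ?_ hle
        rw [div_le_one (by positivity)]
        nlinarith
    _ = (x * y / z) ^ (1 + b) := by
        rw [← mul_rpow (by positivity) hz.le]
        congr 1
        field_simp
    _ ≤ (2 * (x * y / (z + x))) ^ (1 + b) := by
        gcongr
        rw [← mul_div_assoc, div_le_div_iff₀ hz (by positivity)]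
        nlinarith [mul_pos hx hy]
    _ ≤ _ := le_div_self (by positivity) hβ hle

theorem rpow_le_max_rpow (a : ℝ) {x u y : ℝ} (hx : 0 < x) (hxu : x ≤ u) (huy : u ≤ y) :
    u ^ a ≤ max (x ^ a) (y ^ a) := by
  rcases le_or_gt 0 a with ha | ha
  · exact le_max_of_le_right (rpow_le_rpow (hx.trans_le hxu).le huy ha)
  · exact le_max_of_le_left (rpow_le_rpow_of_nonpos hx hxu ha.le)

theorem integral_increment_kernel_le (a : ℝ) {b t s t' s' : ℝ} (hb : -1 < b) (hb0 : b ≤ 0)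
    (h0 : 0 < s') (h1 : s' < t') (h2 : t' < s) (h3 : s < t) :
    ∫ u in s'..t', u ^ a * ((s - u) ^ b - (t - u) ^ b) ≤
      2 ^ (1 + b) / (1 + b) * (max (s' ^ a) (s ^ a) *
        (((t - s) * (t' - s')) ^ (1 + b) * (t - t') ^ (-(1 + b)))) := by
  have hM : 0 ≤ max (s' ^ a) (s ^ a) := le_max_of_le_left (rpow_nonneg h0.le _)
  calc ∫ u in s'..t', u ^ a * ((s - u) ^ b - (t - u) ^ b)
      ≤ ∫ u in s'..t', max (s' ^ a) (s ^ a) * ((s - u) ^ b - (t - u) ^ b) := by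
        refine intervalIntegral.integral_mono_on h1.le
          (intervalIntegrable_increment_kernel a b h0 h1.le h2 h3)
          (((continuousOn_sub_rpow b h1.le h2).sub
            (continuousOn_sub_rpow b h1.le (h2.trans h3))).intervalIntegrable.const_mul _)
          fun u hu => ?_
        refine mul_le_mul_of_nonneg_right
          (rpow_le_max_rpow a h0 hu.1 (hu.2.trans h2.le)) (sub_nonneg.2 ?_)
        exact rpow_le_rpow_of_nonpos (by linarith [hu.2]) (by linarith) hb0
    _ ≤ _ := by
        rw [intervalIntegral.integral_const_mul]
        refine (mul_le_mul_of_nonneg_left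
          (integral_sub_rpow_sub_rpow_le hb hb0 h1 h2 h3) hM).trans_eq ?_
        ring

theorem le_rpow_mul_rpow_of_le {I A B α : ℝ} (hα : α ∈ Set.Icc (0 : ℝ) 1) (hI : 0 ≤ I)
    (hA : I ≤ A) (hB : I ≤ B) : I ≤ A ^ α * B ^ (1 - α) := by
  calc I = I ^ α * I ^ (1 - α) := by
        rw [← rpow_add_of_nonneg hI hα.1 (by linarith [hα.2])]
        simp
    _ ≤ A ^ α * B ^ (1 - α) := by
        have h := hα.1
        have h' : 0 ≤ 1 - α := by linarith [hα.2]
        have hA0 : 0 ≤ A := hI.trans hA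
        gcongr

theorem stmt_5 (a b α : ℝ) (ha : -1 < a) (hb0 : -1 < b) (hb1 : b < 0) (hb2 : |b| < 1 + a)
    (hα : α ∈ Set.Icc (0:ℝ) 1) :
    ∃ C > (0:ℝ), ∀ t s t' s' : ℝ, 0 < s' → s' < t' → t' < s → s < t →
      (1 / (2 * Beta (a + 1) (b + 1))) *
          (∫ u in s'..t', u ^ a * ((s - u) ^ b - (t - u) ^ b)) ≤
        C * (max (s' ^ a) (s ^ a)) ^ α * (t * t') ^ (a * (1 - α) / 2) *
          ((t - s) * (t' - s')) ^ ((1 + b) * (1 + α) / 2) * (t - t') ^ (-((1 + b) * α)) := by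
  have hβ : 0 < 1 + b := by linarith
  have hab : 0 ≤ a + (1 + b) := by
    rw [abs_of_neg hb1] at hb2
    linarith
  obtain ⟨K, hK, hKle⟩ := exists_integral_beta_kernel_le ha hb0
  have hBeta : 0 < Beta (a + 1) (b + 1) :=
    ProbabilityTheory.beta_pos (by linarith) (by linarith)
  have hc : 0 < 1 / (2 * Beta (a + 1) (b + 1)) := by positivity
  refine ⟨1 / (2 * Beta (a + 1) (b + 1)) * ((2 ^ (1 + b) / (1 + b)) ^ α * K ^ (1 - α)),
    by positivity, fun t s t' s' h0 h1 h2 h3 => ?_⟩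
  set I := ∫ u in s'..t', u ^ a * ((s - u) ^ b - (t - u) ^ b)
  have hI0 : 0 ≤ I := intervalIntegral.integral_nonneg h1.le fun u hu =>
    increment_kernel_nonneg a hb1.le (h0.le.trans hu.1) (hu.2.trans_lt h2) h3.le
  have hI1 := integral_increment_kernel_le a hb0 hb1.le h0 h1 h2 h3
  have hpast := (integral_increment_kernel_le_past a hb0 hb1.le h0 h1 h2 h3).trans
    (hKle s' t' h0 h1)
  have hfuture := (integral_increment_kernel_le_future ha hb0 hb1.le hab h0 h1 h2 h3).trans
    (hKle s t (by linarith) h3)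
  have ht' : 0 < t' := h0.trans h1
  have ht : 0 < t := by linarith
  have hx : 0 < t - s := by linarith
  have hy : 0 < t' - s' := by linarith
  have hw : 0 < t - t' := by linarith
  have hM : 0 < max (s' ^ a) (s ^ a) := lt_max_of_lt_left (rpow_pos_of_pos h0 _)
  have hI2 := le_rpow_mul_rpow_of_le (α := 1 / 2) ⟨by norm_num, by norm_num⟩ hI0 hpast hfuture
  have hI := le_rpow_mul_rpow_of_le hα hI0 hI1 hI2
  rw [mul_assoc, mul_assoc, mul_assoc, mul_assoc]
  refine mul_le_mul_of_nonneg_left (hI.trans_eq ?_) hc.le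
  generalize max (s' ^ a) (s ^ a) = M at hM
  generalize t - s = x at hx
  generalize t' - s' = y at hy
  generalize t - t' = w at hw
  have hL : 0 < 2 ^ (1 + b) / (1 + b) := by positivity
  generalize 2 ^ (1 + b) / (1 + b) = L at hL
  have e1 : (L * (M * ((x * y) ^ (1 + b) * w ^ (-(1 + b))))) ^ α =
      L ^ α * (M ^ α * ((x * y) ^ ((1 + b) * α) * w ^ (-((1 + b) * α)))) := by
    rw [mul_rpow hL.le (by positivity), mul_rpow hM.le (by positivity),
      mul_rpow (by positivity) (by positivity), ← rpow_mul (by positivity), ← rpow_mul hw.le,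
      neg_mul]
  have e2 : (K * (t' ^ a * y ^ (1 + b))) ^ (1 / 2 : ℝ) *
      (K * (t ^ a * x ^ (1 + b))) ^ (1 - 1 / 2 : ℝ) =
      K * ((t * t') ^ (a / 2) * (x * y) ^ ((1 + b) / 2)) := by
    rw [show (1 - 1 / 2 : ℝ) = 1 / 2 by norm_num, ← mul_rpow (by positivity) (by positivity),
      show K * (t' ^ a * y ^ (1 + b)) * (K * (t ^ a * x ^ (1 + b))) =
        K ^ 2 * ((t * t') ^ a * (x * y) ^ (1 + b)) by
          rw [mul_rpow ht.le ht'.le, mul_rpow hx.le hy.le]; ring,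
      mul_rpow (by positivity) (by positivity), mul_rpow (by positivity) (by positivity),
      ← rpow_mul (by positivity), ← rpow_mul (by positivity), ← sqrt_eq_rpow, sqrt_sq hK.le,
      mul_one_div, mul_one_div]
  have e3 : (K * ((t * t') ^ (a / 2) * (x * y) ^ ((1 + b) / 2))) ^ (1 - α) =
      K ^ (1 - α) * ((t * t') ^ (a * (1 - α) / 2) * (x * y) ^ ((1 + b) / 2 * (1 - α))) := by
    rw [mul_rpow hK.le (by positivity), mul_rpow (by positivity) (by positivity),
      ← rpow_mul (by positivity), ← rpow_mul (by positivity), div_mul_eq_mul_div]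
  have e4 : (x * y) ^ ((1 + b) * (1 + α) / 2) =
      (x * y) ^ ((1 + b) * α) * (x * y) ^ ((1 + b) / 2 * (1 - α)) := by
    rw [← rpow_add (by positivity)]
    congr 1
    ring
  rw [e1, e2, e3, e4]
  ring
end
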